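/- Let K ⊆ ℝ² be a nonempty compact set and suppose there are constants C₀ > 0 and δ₀ > 0 such that area({x ∈ ℝ² : dist(x,K) ≤ δ}) ≤ C₀·δ for all δ ∈ (0,δ₀]. Let ℓ > 0 satisfy ℓ·√2 ≤ δ₀, and let (Q_i)_{i∈I} be a family of axis-parallel closed squares of side length ℓ with pairwise disjoint interiors, each of which intersects K. Then I is finite with card(I) ≤ √2·C₀·ℓ^{−1}, and the total area of the squares satisfies Σ_{i∈I} area(Q_i) ≤ √2·C₀·ℓ. -/

import Mathlib

open MeasureTheory

/-- The axis-parallel closed cube of side `ℓ` with lowest corner `c`, as a preimage of a box. -/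
theorem setOf_forall_mem_Icc_eq_preimage {n : ℕ} (c : EuclideanSpace ℝ (Fin n)) (ℓ : ℝ) :
    {x : EuclideanSpace ℝ (Fin n) | ∀ j, x j ∈ Set.Icc (c j) (c j + ℓ)} =
      WithLp.ofLp ⁻¹' Set.Icc (fun j => c j) (fun j => c j + ℓ) := by
  ext x
  simp [Pi.le_def, forall_and]

theorem volume_setOf_forall_mem_Icc {n : ℕ} (c : EuclideanSpace ℝ (Fin n)) (ℓ : ℝ) :
    volume {x : EuclideanSpace ℝ (Fin n) | ∀ j, x j ∈ Set.Icc (c j) (c j + ℓ)} =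
      ENNReal.ofReal ℓ ^ n := by
  rw [setOf_forall_mem_Icc_eq_preimage,
    (PiLp.volume_preserving_ofLp (Fin n)).measure_preimage
      measurableSet_Icc.nullMeasurableSet, Real.volume_Icc_pi]
  simp

theorem convex_setOf_forall_mem_Icc {n : ℕ} (c : EuclideanSpace ℝ (Fin n)) (ℓ : ℝ) :
    Convex ℝ {x : EuclideanSpace ℝ (Fin n) | ∀ j, x j ∈ Set.Icc (c j) (c j + ℓ)} := by
  rw [setOf_forall_mem_Icc_eq_preimage]
  exact (convex_Icc _ _).linear_preimage (WithLp.linearEquiv 2 ℝ (Fin n → ℝ)).toLinearMap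

theorem dist_le_of_forall_mem_Icc {n : ℕ} {c x y : EuclideanSpace ℝ (Fin n)} {ℓ : ℝ} (hℓ : 0 ≤ ℓ)
    (hx : ∀ j, x j ∈ Set.Icc (c j) (c j + ℓ)) (hy : ∀ j, y j ∈ Set.Icc (c j) (c j + ℓ)) :
    dist x y ≤ ℓ * Real.sqrt n := by
  rw [EuclideanSpace.dist_eq]
  apply Real.sqrt_le_iff.2 ⟨by positivity, ?_⟩
  have hsum : ∑ j, dist (x j) (y j) ^ 2 ≤ ∑ _j : Fin n, ℓ ^ 2 := by
    refine Finset.sum_le_sum fun j _ => pow_le_pow_left₀ dist_nonneg ?_ 2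
    rw [Real.dist_eq, abs_sub_le_iff]
    constructor <;> linarith [(hx j).1, (hx j).2, (hy j).1, (hy j).2]
  rw [mul_pow, Real.sq_sqrt n.cast_nonneg]
  simpa [mul_comm] using hsum

/-- Convex sets with pairwise disjoint interiors satisfy the same packing bound as disjoint sets. -/
theorem tsum_measure_le_of_pairwise_disjoint_interior {ι E : Type*} [NormedAddCommGroup E]
    [NormedSpace ℝ E] [MeasurableSpace E] [BorelSpace E] [FiniteDimensional ℝ E]
    (μ : Measure E) [μ.IsAddHaarMeasure] {Q : ι → Set E} {s : Set E}
    (hconv : ∀ i, Convex ℝ (Q i))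
    (hdisj : Pairwise fun i j => Disjoint (interior (Q i)) (interior (Q j)))
    (hsub : ∀ i, Q i ⊆ s) : ∑' i, μ (Q i) ≤ μ s := by
  calc ∑' i, μ (Q i) = ∑' i, μ (interior (Q i)) := by
        refine tsum_congr fun i => ?_
        exact (measure_congr (interior_ae_eq_of_null_frontier ((hconv i).addHaar_frontier μ))).symm
    _ ≤ μ (⋃ i, interior (Q i)) :=
        tsum_meas_le_meas_iUnion_of_disjoint μ (fun _ => isOpen_interior.measurableSet) hdisj
    _ ≤ μ s := measure_mono (Set.iUnion_subset fun i => interior_subset.trans (hsub i))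

/-- Square-counting near a compact set in `ℝ²` with a one-sided upper Minkowski content bound:
if `area({dist(·,K) ≤ δ}) ≤ C₀δ` for `δ ∈ (0,δ₀]`, `ℓ√2 ≤ δ₀`, and `(Q_i)` is a family of
axis-parallel closed squares of side `ℓ` with pairwise disjoint interiors, each meeting `K`,
then the family is finite, has at most `√2·C₀·ℓ⁻¹` members, and its total area is at most
`√2·C₀·ℓ`. -/
theorem square_counting_near_compact_set_2d
    (K : Set (EuclideanSpace ℝ (Fin 2))) (hK : IsCompact K) (hKne : K.Nonempty)
    (C₀ δ₀ : ℝ) (hC₀ : 0 < C₀) (hδ₀ : 0 < δ₀)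
    (hmink : ∀ δ ∈ Set.Ioc (0 : ℝ) δ₀,
      volume (Metric.cthickening δ K) ≤ ENNReal.ofReal (C₀ * δ))
    (ℓ : ℝ) (hℓ : 0 < ℓ) (hℓδ : ℓ * Real.sqrt 2 ≤ δ₀)
    (I : Type) (Q : I → Set (EuclideanSpace ℝ (Fin 2)))
    (hQsq : ∀ i, ∃ c : EuclideanSpace ℝ (Fin 2),
      Q i = {x | ∀ j, x j ∈ Set.Icc (c j) (c j + ℓ)})
    (hQdisj : Pairwise fun i j => Disjoint (interior (Q i)) (interior (Q j)))
    (hQK : ∀ i, (Q i ∩ K).Nonempty) :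
    Finite I ∧ (Nat.card I : ℝ) ≤ Real.sqrt 2 * C₀ / ℓ ∧
    (∑' i, volume (Q i)) ≤ ENNReal.ofReal (Real.sqrt 2 * C₀ * ℓ) := by
  have hsub : ∀ i, Q i ⊆ Metric.cthickening (ℓ * Real.sqrt 2) K := by
    intro i x hx
    obtain ⟨y, hyQ, hyK⟩ := hQK i
    obtain ⟨c, hc⟩ := hQsq i
    rw [hc] at hx hyQ
    exact Metric.mem_cthickening_of_dist_le x y _ K hyK
      (by simpa using dist_le_of_forall_mem_Icc hℓ.le hx hyQ)
  have hvol : ∀ i, volume (Q i) = ENNReal.ofReal (ℓ ^ 2) := by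
    intro i
    obtain ⟨c, hc⟩ := hQsq i
    rw [hc, volume_setOf_forall_mem_Icc, ENNReal.ofReal_pow hℓ.le]
  have hconv : ∀ i, Convex ℝ (Q i) := by
    intro i
    obtain ⟨c, hc⟩ := hQsq i
    exact hc ▸ convex_setOf_forall_mem_Icc c ℓ
  have harea : ∑' i, volume (Q i) ≤ ENNReal.ofReal (Real.sqrt 2 * C₀ * ℓ) := by
    refine (tsum_measure_le_of_pairwise_disjoint_interior volume hconv hQdisj hsub).trans
      ((hmink _ ⟨by positivity, hℓδ⟩).trans_eq ?_)
    congr 1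
    ring
  have hfin : Finite I := by
    by_contra hinf
    rw [not_finite_iff_infinite] at hinf
    refine absurd harea (not_le.2 ?_)
    simp only [hvol]
    rw [ENNReal.tsum_const_eq_top_of_ne_zero (by simpa using hℓ.ne.symm)]
    exact ENNReal.ofReal_lt_top
  refine ⟨hfin, ?_, harea⟩
  have := Fintype.ofFinite I
  simp only [hvol, tsum_fintype, Finset.sum_const, nsmul_eq_mul, Finset.card_univ] at harea
  rw [← ENNReal.ofReal_natCast, ← ENNReal.ofReal_mul (Nat.cast_nonneg _),
    ENNReal.ofReal_le_ofReal_iff (by positivity)] at harea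
  rw [Nat.card_eq_fintype_card, le_div_iff₀ hℓ]
  exact le_of_mul_le_mul_right (by linarith) hℓ
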